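/- Let Ω ⊆ ℝ³ be a domain convex in the direction of the line L₁ and assume that at least one number in each of the pairs (a₁, b₁) and (a₂, b₂) lies in ℂ∖ℝ. Then every right-G-monogenic mapping Φ₂₀ : Ω_ζ → 𝓘₂ has the form Φ₂₀(ζ) = F₂₁(ξ₁)e₁ + F₂₃(ξ₁)e₃ for all ζ = x i₁ + y i₂ + z i₃ ∈ Ω_ζ, and every left-G-monogenic mapping Φ̂₂₀ : Ω_ζ → 𝓘̂₂ has the form Φ̂₂₀(ζ) = F₂₂(ξ₁)e₁ + F₂₄(ξ₁)e₄, where F₂₁, F₂₃, F₂₂, F₂₄ are analytic functions on D₁ of the complex variable ξ₁ = x + y a₁ + z b₁. -/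

import Mathlib

open Filter Set Topology Quaternion

noncomputable section

abbrev HC : Type := ℍ[ℂ, -1, -1]

/-- The idempotent `e₁ = (1 + iI)/2`. -/
def e1 : HC := ⟨1/2, Complex.I/2, 0, 0⟩
/-- The idempotent `e₂ = (1 - iI)/2`. -/
def e2 : HC := ⟨1/2, -(Complex.I/2), 0, 0⟩
/-- `e₃ = (iJ - K)/2`. -/
def e3 : HC := ⟨0, 0, Complex.I/2, -(1/2)⟩
/-- `e₄ = (iJ + K)/2`. -/
def e4 : HC := ⟨0, 0, Complex.I/2, 1/2⟩

/-- Topology on `ℍ(ℂ)` induced from the four complex coordinates. -/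
instance : TopologicalSpace HC :=
  TopologicalSpace.induced (fun q : HC => (q.re, q.imI, q.imJ, q.imK)) inferInstance

/-- Coordinate of `a ∈ ℍ(ℂ)` at `e₁` in the basis `{e₁, e₂, e₃, e₄}`. -/
def c1 (a : HC) : ℂ := a.re - Complex.I * a.imI
/-- Coordinate at `e₂`. -/
def c2 (a : HC) : ℂ := a.re + Complex.I * a.imI
/-- Coordinate at `e₃`. -/
def c3 (a : HC) : ℂ := -(Complex.I * a.imJ) - a.imK
/-- Coordinate at `e₄`. -/
def c4 (a : HC) : ℂ := -(Complex.I * a.imJ) + a.imK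

/-- The norm `‖a‖ = √(|a₁|² + |a₂|² + |a₃|² + |a₄|²)`, coordinates in the basis `{e₁,e₂,e₃,e₄}`. -/
def qnorm (a : HC) : ℝ :=
  Real.sqrt (‖c1 a‖ ^ 2 + ‖c2 a‖ ^ 2 +
    ‖c3 a‖ ^ 2 + ‖c4 a‖ ^ 2)

/-- `f₁ : ℍ(ℂ) → ℂ`, the ℂ-linear functional with `f₁(e₁) = f₁(e₃) = 1`, `f₁(e₂) = f₁(e₄) = 0`. -/
def f1 (a : HC) : ℂ := c1 a + c3 a
/-- `f₂ : ℍ(ℂ) → ℂ`, with `f₂(e₂) = f₂(e₄) = 1`, `f₂(e₁) = f₂(e₃) = 0`. -/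
def f2 (a : HC) : ℂ := c2 a + c4 a
/-- `f̂₁ : ℍ(ℂ) → ℂ`, with `f̂₁(e₁) = f̂₁(e₄) = 1`, `f̂₁(e₂) = f̂₁(e₃) = 0`. -/
def fh1 (a : HC) : ℂ := c1 a + c4 a
/-- `f̂₂ : ℍ(ℂ) → ℂ`, with `f̂₂(e₂) = f̂₂(e₃) = 1`, `f̂₂(e₁) = f̂₂(e₄) = 0`. -/
def fh2 (a : HC) : ℂ := c2 a + c3 a

/-- `ζ = x i₁ + y i₂ + z i₃` for `p = (x, y, z) ∈ ℝ³` (with `i₁ = 1`). -/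
def zeta (i2 i3 : HC) (p : ℝ × ℝ × ℝ) : HC :=
  (p.1 : ℂ) • (1 : HC) + (p.2.1 : ℂ) • i2 + (p.2.2 : ℂ) • i3

/-- The real linear span `E₃` of `i₁ = 1, i₂, i₃`. -/
def E3 (i2 i3 : HC) : Set HC := Set.range (zeta i2 i3)

/-- `i₁ = 1, i₂, i₃` are linearly independent over `ℝ`. -/
def LinIndep (i2 i3 : HC) : Prop :=
  ∀ α₁ α₂ α₃ : ℝ, (α₁ : ℂ) • (1 : HC) + (α₂ : ℂ) • i2 + (α₃ : ℂ) • i3 = 0 →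
    α₁ = 0 ∧ α₂ = 0 ∧ α₃ = 0

/-- `Φ` is right-G-monogenic on `S` (w.r.t. directions in `E₃`): it is continuous on `S` and at
every `ζ ∈ S` there is `Φ'(ζ)` with `lim_{ε→0+} (Φ(ζ+εh) − Φ(ζ))ε⁻¹ = h·Φ'(ζ)` for all `h ∈ E₃`. -/
def RightGMonogenic (i2 i3 : HC) (Φ : HC → HC) (S : Set HC) : Prop :=
  ContinuousOn Φ S ∧ ∀ ζ ∈ S, ∃ Φ' : HC, ∀ h ∈ E3 i2 i3,
    Tendsto (fun ε : ℝ => ((ε : ℂ))⁻¹ • (Φ (ζ + (ε : ℂ) • h) - Φ ζ))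
      (nhdsWithin 0 (Set.Ioi 0)) (nhds (h * Φ'))

/-- `Φ̂` is left-G-monogenic on `S`. -/
def LeftGMonogenic (i2 i3 : HC) (Φ : HC → HC) (S : Set HC) : Prop :=
  ContinuousOn Φ S ∧ ∀ ζ ∈ S, ∃ Φ' : HC, ∀ h ∈ E3 i2 i3,
    Tendsto (fun ε : ℝ => ((ε : ℂ))⁻¹ • (Φ (ζ + (ε : ℂ) • h) - Φ ζ))
      (nhdsWithin 0 (Set.Ioi 0)) (nhds (Φ' * h))

/-- The right maximal ideal `𝓘₁ = {λ₂e₂ + λ₄e₄}`. -/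
def I1 : Set HC := {a | ∃ l2 l4 : ℂ, a = l2 • e2 + l4 • e4}
/-- The right maximal ideal `𝓘₂ = {λ₁e₁ + λ₃e₃}`. -/
def I2 : Set HC := {a | ∃ l1 l3 : ℂ, a = l1 • e1 + l3 • e3}
/-- The left maximal ideal `𝓘̂₁ = {λ₂e₂ + λ₃e₃}`. -/
def Ih1 : Set HC := {a | ∃ l2 l3 : ℂ, a = l2 • e2 + l3 • e3}
/-- The left maximal ideal `𝓘̂₂ = {λ₁e₁ + λ₄e₄}`. -/
def Ih2 : Set HC := {a | ∃ l1 l4 : ℂ, a = l1 • e1 + l4 • e4}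

/-- The line `L` in `ℝ³` given by `x + y·Re a + z·Re b = 0`, `y·Im a + z·Im b = 0`. -/
def lineL (a b : ℂ) : Set (ℝ × ℝ × ℝ) :=
  {p | p.1 + p.2.1 * a.re + p.2.2 * b.re = 0 ∧ p.2.1 * a.im + p.2.2 * b.im = 0}

/-- `Ω` is convex in the direction of the line `L` (a line through the origin): it contains every
segment parallel to `L` joining two of its points. -/
def ConvexInDirection (Ω : Set (ℝ × ℝ × ℝ)) (L : Set (ℝ × ℝ × ℝ)) : Prop :=
  ∀ p ∈ Ω, ∀ q ∈ Ω, q - p ∈ L → segment ℝ p q ⊆ Ω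

/-- `ξ = x + y·a + z·b` for `p = (x,y,z)`. -/
def xi (a b : ℂ) (p : ℝ × ℝ × ℝ) : ℂ := (p.1 : ℂ) + (p.2.1 : ℂ) * a + (p.2.2 : ℂ) * b


/-- `Φ'` is a right Gateaux derivative of `Φ` on `S` (directions in `E₃`). -/
def IsRightGDeriv (i2 i3 : HC) (Φ Φ' : HC → HC) (S : Set HC) : Prop :=
  ∀ ζ ∈ S, ∀ h ∈ E3 i2 i3,
    Tendsto (fun ε : ℝ => ((ε : ℂ))⁻¹ • (Φ (ζ + (ε : ℂ) • h) - Φ ζ))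
      (nhdsWithin 0 (Set.Ioi 0)) (nhds (h * Φ' ζ))

/-- `Φ'` is a left Gateaux derivative of `Φ` on `S`. -/
def IsLeftGDeriv (i2 i3 : HC) (Φ Φ' : HC → HC) (S : Set HC) : Prop :=
  ∀ ζ ∈ S, ∀ h ∈ E3 i2 i3,
    Tendsto (fun ε : ℝ => ((ε : ℂ))⁻¹ • (Φ (ζ + (ε : ℂ) • h) - Φ ζ))
      (nhdsWithin 0 (Set.Ioi 0)) (nhds (Φ' ζ * h))

/-- Triples `(α, β, γ)` of naturals with `α + β + γ = n`. -/
def trip (n : ℕ) : Finset (ℕ × ℕ × ℕ) :=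
  (Finset.range (n + 1) ×ˢ Finset.range (n + 1) ×ˢ Finset.range (n + 1)).filter
    (fun u => u.1 + u.2.1 + u.2.2 = n)


def GatDiff (F : ℂ → ℂ) (w : ℂ) : Prop :=
  ∃ d : ℂ, ∀ v : ℂ, Tendsto (fun ε : ℝ => ((ε : ℂ))⁻¹ * (F (w + (ε : ℂ) * v) - F w))
      (nhdsWithin 0 (Set.Ioi 0)) (nhds (v * d))

lemma aux_exp_bound (x : ℝ) (hx : 0 ≤ x) : x ^ 2 * Real.exp (-x) ≤ 2 := by
  have h := Real.quadratic_le_exp_of_nonneg hx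
  rw [Real.exp_neg, ← div_eq_mul_inv, div_le_iff₀ (Real.exp_pos x)]
  nlinarith

lemma aux_norm_exp (ε : ℝ) (hε : 0 < ε) (z : ℂ) (hz : z ≠ 0) (h1 : 0 ≤ z.re) (h2 : 0 ≤ z.im) :
    ‖Complex.exp (-(ε : ℂ) * (1 + Complex.I) / z)‖ ≤ Real.exp (-(ε / ‖z‖)) := by
  rw [Complex.norm_exp, Real.exp_le_exp]
  have hn : 0 < ‖z‖ := norm_pos_iff.mpr hz
  have hre : (-(ε : ℂ) * (1 + Complex.I) / z).re = -(ε * (z.re + z.im) / ‖z‖ ^ 2) := by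
    rw [Complex.div_re, Complex.normSq_eq_norm_sq]
    simp
    ring
  rw [hre, neg_le_neg_iff, div_le_div_iff₀ hn (by positivity)]
  have hle : ‖z‖ ≤ z.re + z.im := by
    have := Complex.norm_le_abs_re_add_abs_im z
    rwa [abs_of_nonneg h1, abs_of_nonneg h2] at this
  have : ε * ‖z‖ * ‖z‖ ≤ ε * (z.re + z.im) * ‖z‖ := by gcongr
  nlinarith

lemma phragmen (V : Set ℂ) (C B : ℝ) (hB : 0 ≤ B) (hC : 0 ≤ C) (G : ℂ → ℂ)
    (hbd : Bornology.IsBounded V) (hV : ∀ z ∈ V, 0 < z.re ∧ 0 < z.im)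
    (hd : DiffContOnCl ℂ G V) (hGB : ∀ z ∈ closure V, ‖G z‖ ≤ B)
    (hfr : ∀ z ∈ frontier V, ‖G z‖ ≤ C * ‖z‖) : ∀ z ∈ V, ‖G z‖ ≤ C * ‖z‖ := by
  have hcl : ∀ z ∈ closure V, 0 ≤ z.re ∧ 0 ≤ z.im := by
    intro z hz
    have hc : IsClosed {z : ℂ | 0 ≤ z.re ∧ 0 ≤ z.im} :=
      (isClosed_le continuous_const Complex.continuous_re).inter
        (isClosed_le continuous_const Complex.continuous_im)
    have hsub : V ⊆ {z : ℂ | 0 ≤ z.re ∧ 0 ≤ z.im} := fun z hz => ⟨(hV z hz).1.le, (hV z hz).2.le⟩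
    exact closure_minimal hsub hc hz
  have key : ∀ ε : ℝ, 0 < ε → ∀ z ∈ V,
      ‖G z / z * Complex.exp (-(ε : ℂ) * (1 + Complex.I) / z)‖ ≤ C := by
    intro ε hε z hz
    have hbnd : ∀ z ∈ closure V,
        ‖G z / z * Complex.exp (-(ε : ℂ) * (1 + Complex.I) / z)‖ ≤ 2 * B / ε ^ 2 * ‖z‖ := by
      intro z hz
      by_cases h0 : z = 0
      · simp [h0]
      have hn : 0 < ‖z‖ := norm_pos_iff.mpr h0
      have h1 := aux_norm_exp ε hε z h0 (hcl z hz).1 (hcl z hz).2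
      have h2 := aux_exp_bound (ε / ‖z‖) (by positivity)
      rw [norm_mul, norm_div]
      calc ‖G z‖ / ‖z‖ * ‖Complex.exp (-(ε : ℂ) * (1 + Complex.I) / z)‖
          ≤ B / ‖z‖ * Real.exp (-(ε / ‖z‖)) := by
            gcongr
            exact hGB z hz
        _ = B / ε ^ 2 * ‖z‖ * ((ε / ‖z‖) ^ 2 * Real.exp (-(ε / ‖z‖))) := by
            field_simp
        _ ≤ B / ε ^ 2 * ‖z‖ * 2 := by gcongr
        _ = _ := by ring
    refine Complex.norm_le_of_forall_mem_frontier_norm_le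
      (f := fun z => G z / z * Complex.exp (-(ε : ℂ) * (1 + Complex.I) / z)) hbd ⟨?_, ?_⟩ ?_
      (subset_closure hz)
    · intro z hz
      have h0 : z ≠ 0 := by rintro rfl; simpa using (hV 0 hz).1
      have hG := hd.differentiableOn z hz
      have hid : DifferentiableWithinAt ℂ (fun z : ℂ => z) V z := differentiableWithinAt_id
      exact (hG.div hid h0).mul (((differentiableWithinAt_const _).div hid h0).cexp)
    · intro z hz
      by_cases h0 : z = 0
      · subst h0
        have hz0 : (fun z => G z / z * Complex.exp (-(ε : ℂ) * (1 + Complex.I) / z)) 0 = 0 := by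
          simp
        unfold ContinuousWithinAt
        rw [hz0]
        refine squeeze_zero_norm' (a := fun z : ℂ => 2 * B / ε ^ 2 * ‖z‖) ?_ ?_
        · filter_upwards [self_mem_nhdsWithin] with z hz using hbnd z hz
        · have : Tendsto (fun z : ℂ => 2 * B / ε ^ 2 * ‖z‖) (𝓝 0) (𝓝 (2 * B / ε ^ 2 * ‖(0:ℂ)‖)) :=
            (continuous_const.mul continuous_norm).tendsto 0
          simp only [norm_zero, mul_zero] at this
          exact this.mono_left nhdsWithin_le_nhds
      · have hG := hd.continuousOn z hz
        have hid : ContinuousWithinAt (fun z : ℂ => z) (closure V) z := continuousWithinAt_id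
        exact (hG.div hid h0).mul ((continuousWithinAt_const.div hid h0).cexp)
    · intro z hz
      by_cases h0 : z = 0
      · simp [h0, hC]
      have hn : 0 < ‖z‖ := norm_pos_iff.mpr h0
      have hzc := hcl z (frontier_subset_closure hz)
      have h1 := aux_norm_exp ε hε z h0 hzc.1 hzc.2
      have h3 : Real.exp (-(ε / ‖z‖)) ≤ 1 := by
        rw [Real.exp_le_one_iff]
        have : 0 ≤ ε / ‖z‖ := by positivity
        linarith
      rw [norm_mul, norm_div]
      have h4 : ‖G z‖ / ‖z‖ ≤ C := by
        rw [div_le_iff₀ hn]; exact hfr z hz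
      calc _ ≤ C * 1 := by
            gcongr
            exact h1.trans h3
        _ = C := mul_one C
  intro z hz
  have h0 : z ≠ 0 := by rintro rfl; simpa using (hV 0 hz).1
  have hn : 0 < ‖z‖ := norm_pos_iff.mpr h0
  have hlim : Tendsto (fun ε : ℝ => ‖G z / z * Complex.exp (-(ε : ℂ) * (1 + Complex.I) / z)‖)
      (𝓝[>] 0) (𝓝 ‖G z / z‖) := by
    have hc : Continuous (fun ε : ℝ =>
        ‖G z / z * Complex.exp (-(ε : ℂ) * (1 + Complex.I) / z)‖) := by fun_prop
    have := hc.tendsto 0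
    simp only [Complex.ofReal_zero, neg_zero, zero_mul, zero_div, Complex.exp_zero, mul_one] at this
    exact this.mono_left nhdsWithin_le_nhds
  have := le_of_tendsto hlim (by
    filter_upwards [self_mem_nhdsWithin] with ε hε using key ε hε z hz)
  rwa [norm_div, div_le_iff₀ hn] at this

/-- Lipschitz along the cross at `e`. -/
def CrossLip (F : ℂ → ℂ) (U : Set ℂ) (N : ℝ) (e : ℂ) : Prop :=
  ∀ t : ℝ, 0 ≤ t → t ≤ 1 / N → ∀ k : Fin 4, e + t * Complex.I ^ (k : ℕ) ∈ U →
    ‖F (e + t * Complex.I ^ (k : ℕ)) - F e‖ ≤ N * t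

lemma exists_crossLip (F : ℂ → ℂ) (U : Set ℂ) (e : ℂ) (h : GatDiff F e) :
    ∃ n : ℕ, CrossLip F U (n + 1) e := by
  obtain ⟨d, hd⟩ := h
  have h1 : ∀ k : Fin 4, ∀ᶠ ε : ℝ in 𝓝[>] 0,
      ‖((ε : ℂ))⁻¹ * (F (e + (ε : ℂ) * Complex.I ^ (k : ℕ)) - F e)‖ < ‖d‖ + 1 := by
    intro k
    have := (hd (Complex.I ^ (k : ℕ))).norm
    refine this.eventually_lt_const ?_
    simp
  have h2 := eventually_all.mpr h1
  obtain ⟨δ, hδ, h3⟩ := (mem_nhdsGT_iff_exists_Ioo_subset).1 h2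
  have hδ : 0 < δ := hδ
  obtain ⟨n, hn⟩ := exists_nat_gt (max (‖d‖ + 1) (1 / δ))
  refine ⟨n, ?_⟩
  intro t ht0 ht1 k _
  rcases ht0.eq_or_lt with rfl | ht
  · simp
  have hn1 : 1 / δ < n := (le_max_right _ _).trans_lt hn
  have hn2 : ‖d‖ + 1 < n := (le_max_left _ _).trans_lt hn
  have htδ : t < δ := by
    refine ht1.trans_lt ?_
    rw [div_lt_iff₀ hδ] at hn1
    rw [div_lt_iff₀ (by positivity)]
    nlinarith
  have := h3 ⟨ht, htδ⟩ k
  rw [norm_mul, norm_inv, Complex.norm_real, Real.norm_of_nonneg ht0, inv_mul_lt_iff₀ ht] at this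
  nlinarith

lemma cross_portion (F : ℂ → ℂ) (U : Set ℂ) (hU : IsOpen U) (hF : ContinuousOn F U)
    (hG : ∀ w ∈ U, GatDiff F w) (hne : ∃ e ∈ U, ¬ AnalyticAt ℂ F e) :
    ∃ n : ℕ, ∃ e₀ ∈ U, ¬ AnalyticAt ℂ F e₀ ∧ ∃ r > 0, ∀ e ∈ U, ¬ AnalyticAt ℂ F e →
      dist e e₀ < r → CrossLip F U (n + 1) e := by
  let E : Set ℂ := U ∩ {z | AnalyticAt ℂ F z}ᶜ
  have hE : IsLocallyClosed E :=
    hU.isLocallyClosed.inter (isOpen_analyticAt ℂ F).isClosed_compl.isLocallyClosed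
  have : LocallyCompactSpace E := hE.locallyCompactSpace
  have : Nonempty E := by
    obtain ⟨e, h1, h2⟩ := hne
    exact ⟨⟨e, h1, h2⟩⟩
  have hcl : ∀ n : ℕ, IsClosed {e : E | CrossLip F U (n + 1) (e : ℂ)} := by
    intro n
    simp only [CrossLip, ofPred_forall]
    refine isClosed_iInter fun t => isClosed_iInter fun ht0 => isClosed_iInter fun ht1 =>
      isClosed_iInter fun k => ?_
    rw [← isOpen_compl_iff, isOpen_iff_mem_nhds]
    rintro e he
    simp only [mem_compl_iff, mem_ofPred_eq, not_forall, not_le] at he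
    obtain ⟨he1, he2⟩ := he
    have hmap : Continuous (fun e : E => (e : ℂ) + t * Complex.I ^ (k : ℕ)) := by fun_prop
    have hc1 : ContinuousAt F ((e : ℂ) + t * Complex.I ^ (k : ℕ)) :=
      hF.continuousAt (hU.mem_nhds he1)
    have hc2 : ContinuousAt F (e : ℂ) := hF.continuousAt (hU.mem_nhds e.2.1)
    have hc3 : ContinuousAt (fun e : E => ‖F ((e : ℂ) + t * Complex.I ^ (k : ℕ)) - F e‖) e := by
      refine ContinuousAt.norm (ContinuousAt.sub ?_ ?_)
      · exact ContinuousAt.comp (f := fun e : E => (e : ℂ) + t * Complex.I ^ (k : ℕ)) hc1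
          hmap.continuousAt
      · exact ContinuousAt.comp (f := fun e : E => (e : ℂ)) hc2 continuous_subtype_val.continuousAt
    filter_upwards [hc3.eventually (lt_mem_nhds he2),
      hmap.continuousAt.eventually (hU.mem_nhds he1)] with x hx1 hx2
    simp only [mem_compl_iff, mem_ofPred_eq, not_forall, not_le]
    exact ⟨hx2, hx1⟩
  have hun : ⋃ n : ℕ, {e : E | CrossLip F U (n + 1) (e : ℂ)} = univ := by
    refine eq_univ_of_forall fun e => ?_
    obtain ⟨n, hn⟩ := exists_crossLip F U e (hG e e.2.1)
    exact mem_iUnion.2 ⟨n, hn⟩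
  obtain ⟨n, e₀, he₀⟩ := nonempty_interior_of_iUnion_of_closed hcl hun
  obtain ⟨r, hr, hr2⟩ := Metric.mem_nhds_iff.1 (mem_interior_iff_mem_nhds.1 he₀)
  refine ⟨n, e₀, e₀.2.1, e₀.2.2, r, hr, fun e heU hea hed => ?_⟩
  exact hr2 (show (⟨e, heU, hea⟩ : E) ∈ Metric.ball e₀ r from hed)

lemma I_pow_norm (k : Fin 4) : ‖Complex.I ^ (k : ℕ)‖ = 1 := by simp

lemma exists_quadrant (w : ℂ) : ∃ k : Fin 4, ∃ ζ : ℂ, w = Complex.I ^ (k : ℕ) * ζ ∧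
    0 ≤ ζ.re ∧ 0 ≤ ζ.im := by
  rcases le_total 0 w.re with h1 | h1 <;> rcases le_total 0 w.im with h2 | h2
  · exact ⟨0, w, by simp, h1, h2⟩
  · refine ⟨3, Complex.I * w, ?_, by simpa using h2, by simpa using h1⟩
    rw [← mul_assoc]
    have : Complex.I ^ ((3 : Fin 4) : ℕ) * Complex.I = 1 := by
      change Complex.I ^ 3 * Complex.I = 1
      rw [← pow_succ, Complex.I_pow_four]
    rw [this, one_mul]
  · refine ⟨1, -Complex.I * w, ?_, by simpa using h2, by simpa using h1⟩
    change w = Complex.I ^ 1 * (-Complex.I * w)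
    rw [pow_one, ← mul_assoc, mul_neg, Complex.I_mul_I, neg_neg, one_mul]
  · refine ⟨2, -w, ?_, by simpa using h1, by simpa using h2⟩
    change w = Complex.I ^ 2 * (-w)
    rw [Complex.I_sq]; ring

lemma cross_aligned (F : ℂ → ℂ) (U : Set ℂ) (N : ℝ) (e z : ℂ) (h : CrossLip F U N e)
    (hz : z ∈ U) (hd : ‖z - e‖ ≤ 1 / N) (hal : (z - e).re = 0 ∨ (z - e).im = 0) :
    ‖F z - F e‖ ≤ N * ‖z - e‖ := by
  have key : ∀ k : Fin 4, z - e = (‖z - e‖ : ℂ) * Complex.I ^ (k : ℕ) →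
      ‖F z - F e‖ ≤ N * ‖z - e‖ := by
    intro k hk
    have hz' : e + (‖z - e‖ : ℂ) * Complex.I ^ (k : ℕ) = z := by rw [← hk]; ring
    have := h ‖z - e‖ (norm_nonneg _) hd k (by rw [hz']; exact hz)
    rwa [hz'] at this
  generalize hw : z - e = w at *
  rcases hal with h0 | h0
  · have hn : ‖w‖ = |w.im| := by
      rw [Complex.norm_eq_sqrt_sq_add_sq, h0]; simp [Real.sqrt_sq_eq_abs]
    rcases le_total 0 w.im with h1 | h1
    · apply key 1
      rw [hn, abs_of_nonneg h1]
      apply Complex.ext <;> simp [h0]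
    · apply key 3
      rw [hn, abs_of_nonpos h1]
      change w = _ * Complex.I ^ 3
      rw [Complex.I_pow_three]
      apply Complex.ext <;> simp [h0]
  · have hn : ‖w‖ = |w.re| := by
      rw [Complex.norm_eq_sqrt_sq_add_sq, h0]; simp [Real.sqrt_sq_eq_abs]
    rcases le_total 0 w.re with h1 | h1
    · apply key 0
      rw [hn, abs_of_nonneg h1]
      apply Complex.ext <;> simp [h0]
    · apply key 2
      rw [hn, abs_of_nonpos h1]
      change w = _ * Complex.I ^ 2
      rw [Complex.I_sq]
      apply Complex.ext <;> simp [h0]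

lemma lip_at (F : ℂ → ℂ) (U : Set ℂ) (hF : ContinuousOn F U)
    (N r : ℝ) (hN : 0 < N) (hr : 0 < r) (e₀ : ℂ) (hsub : Metric.ball e₀ (4 * r) ⊆ U)
    (hbd : ∀ z ∈ Metric.ball e₀ (4 * r), ‖F z - F e₀‖ ≤ 1) (hrN : 4 * r ≤ 1 / N)
    (hcr : ∀ e ∈ Metric.ball e₀ (4 * r), ¬ AnalyticAt ℂ F e → CrossLip F U N e)
    (e : ℂ) (he : dist e e₀ < 2 * r) (hea : ¬ AnalyticAt ℂ F e) (z : ℂ) (hz : dist z e < 2 * r) :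
    ‖F z - F e‖ ≤ (2 * N + 1 / r) * ‖z - e‖ := by
  have hin : ∀ z, ‖z - e‖ ≤ 2 * r → z ∈ Metric.ball e₀ (4 * r) := by
    intro z hz
    have := dist_triangle z e e₀
    rw [Metric.mem_ball]
    rw [dist_eq_norm z e] at this
    linarith
  have heb : e ∈ Metric.ball e₀ (4 * r) := hin e (by simp; linarith)
  -- aligned points
  have hal : ∀ z, ‖z - e‖ ≤ 2 * r → ((z - e).re = 0 ∨ (z - e).im = 0) →
      ‖F z - F e‖ ≤ (2 * N + 1 / r) * ‖z - e‖ := by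
    intro z hz h
    have := cross_aligned F U N e z (hcr e heb hea) (hsub (hin z hz)) (by linarith) h
    refine this.trans ?_
    gcongr
    have : 0 < 1 / r := by positivity
    linarith
  -- non analytic points
  have hna : ∀ z, ‖z - e‖ ≤ 2 * r → ¬ AnalyticAt ℂ F z →
      ‖F z - F e‖ ≤ (2 * N + 1 / r) * ‖z - e‖ := by
    intro z hz h
    let c : ℂ := ⟨e.re, z.im⟩
    have hc1 : ‖c - e‖ ≤ ‖z - e‖ := by
      have h1 : ‖c - e‖ = |(z - e).im| := by
        rw [Complex.norm_eq_sqrt_sq_add_sq]; simp [c, Real.sqrt_sq_eq_abs]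
      rw [h1]; exact Complex.abs_im_le_norm _
    have hc2 : ‖c - z‖ ≤ ‖z - e‖ := by
      have h1 : ‖c - z‖ = |(z - e).re| := by
        rw [Complex.norm_eq_sqrt_sq_add_sq]; simp [c, Real.sqrt_sq_eq_abs, abs_sub_comm]
      rw [h1]; exact Complex.abs_re_le_norm _
    have hcU := hsub (hin c (hc1.trans hz))
    have h1 := cross_aligned F U N e c (hcr e heb hea) hcU (by linarith) (Or.inl (by simp [c]))
    have h2 := cross_aligned F U N z c (hcr z (hin z hz) h) hcU (by linarith)
      (Or.inr (by simp [c]))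
    have h3 : ‖F z - F e‖ ≤ ‖F c - F e‖ + ‖F c - F z‖ := by
      have : F z - F e = (F c - F e) - (F c - F z) := by ring
      rw [this]; exact norm_sub_le _ _
    have h4 : N * ‖c - e‖ ≤ N * ‖z - e‖ := by gcongr
    have h5 : N * ‖c - z‖ ≤ N * ‖z - e‖ := by gcongr
    have h6 : 0 ≤ 1 / r * ‖z - e‖ := by positivity
    linarith
  by_cases hza : AnalyticAt ℂ F z
  swap
  · exact hna z (by rw [← dist_eq_norm]; exact hz.le) hza
  obtain ⟨k, ζ, hζ, hre, him⟩ := exists_quadrant (z - e)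
  set u : ℂ := Complex.I ^ (k : ℕ) with hu
  have hun : ‖u‖ = 1 := I_pow_norm k
  have hnorm : ∀ x : ℂ, ‖e + u * x - e‖ = ‖x‖ := by
    intro x
    rw [add_sub_cancel_left, norm_mul, hun, one_mul]
  have hzeq : z = e + u * ζ := by rw [← hζ]; ring
  have halign : ∀ x : ℂ, (x.re = 0 ∨ x.im = 0) →
      ((e + u * x - e).re = 0 ∨ (e + u * x - e).im = 0) := by
    intro x hx
    rw [add_sub_cancel_left, hu]
    fin_cases k
    · simpa using hx
    · simpa [or_comm] using hx
    · simpa using hx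
    · simpa [or_comm, Complex.I_pow_three] using hx
  have hcmap : Continuous (fun x : ℂ => e + u * x) := by fun_prop
  let V : Set ℂ := {x : ℂ | (0 < x.re ∧ 0 < x.im ∧ ‖x‖ < 2 * r) ∧ AnalyticAt ℂ F (e + u * x)}
  have hVo : IsOpen V := by
    refine IsOpen.inter (IsOpen.inter ?_ (IsOpen.inter ?_ ?_)) ?_
    · exact isOpen_lt continuous_const Complex.continuous_re
    · exact isOpen_lt continuous_const Complex.continuous_im
    · exact isOpen_lt continuous_norm continuous_const
    · exact (isOpen_analyticAt ℂ F).preimage hcmap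
  have hVcl : ∀ x ∈ closure V, 0 ≤ x.re ∧ 0 ≤ x.im ∧ ‖x‖ ≤ 2 * r := by
    intro x hx
    have hc : IsClosed {x : ℂ | 0 ≤ x.re ∧ 0 ≤ x.im ∧ ‖x‖ ≤ 2 * r} :=
      (isClosed_le continuous_const Complex.continuous_re).inter
        ((isClosed_le continuous_const Complex.continuous_im).inter
          (isClosed_le continuous_norm continuous_const))
    have hs : V ⊆ {x : ℂ | 0 ≤ x.re ∧ 0 ≤ x.im ∧ ‖x‖ ≤ 2 * r} :=
      fun x hx => ⟨hx.1.1.le, hx.1.2.1.le, hx.1.2.2.le⟩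
    exact closure_minimal hs hc hx
  have hB : ∀ x, ‖x‖ ≤ 2 * r → ‖F (e + u * x) - F e‖ ≤ 2 := by
    intro x hx
    have h1 := hbd (e + u * x) (hin _ (by rw [hnorm]; exact hx))
    have h2 := hbd e heb
    have : F (e + u * x) - F e = (F (e + u * x) - F e₀) - (F e - F e₀) := by ring
    rw [this]
    refine (norm_sub_le _ _).trans (by linarith)
  have hphr := phragmen V (2 * N + 1 / r) 2 (by norm_num) (by positivity)
    (fun x => F (e + u * x) - F e) ?_ ?_ ⟨?_, ?_⟩ ?_ ?_
  · have hζn : ‖ζ‖ < 2 * r := by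
      rw [hzeq, dist_eq_norm, hnorm] at hz; exact hz
    by_cases h0 : ζ.re = 0 ∨ ζ.im = 0
    · rw [hzeq]
      exact hal _ (by rw [hnorm]; exact hζn.le) (halign ζ h0)
    · push Not at h0
      have := hphr ζ ⟨⟨lt_of_le_of_ne hre (Ne.symm h0.1), lt_of_le_of_ne him (Ne.symm h0.2), hζn⟩,
        by rw [← hzeq]; exact hza⟩
      rw [hzeq, hnorm]; exact this
  · refine Metric.isBounded_closedBall (x := (0:ℂ)) (r := 2 * r) |>.subset fun x hx => ?_
    simpa using hx.1.2.2.le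
  · exact fun x hx => ⟨hx.1.1, hx.1.2.1⟩
  · intro x hx
    have h1 : DifferentiableAt ℂ F (e + u * x) := hx.2.differentiableAt
    have h2 : DifferentiableAt ℂ (fun x : ℂ => e + u * x) x := by fun_prop
    exact ((DifferentiableAt.comp x h1 h2).sub_const _).differentiableWithinAt
  · refine ContinuousOn.sub ?_ continuousOn_const
    refine hF.comp hcmap.continuousOn fun x hx => ?_
    exact hsub (hin _ (by rw [hnorm]; exact (hVcl x hx).2.2))
  · exact fun x hx => hB x (hVcl x hx).2.2
  · intro x hx
    have hxc := hVcl x (frontier_subset_closure hx)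
    have hxn : x ∉ V := by
      rw [hVo.frontier_eq] at hx; exact hx.2
    have hxe : ‖e + u * x - e‖ ≤ 2 * r := by rw [hnorm]; exact hxc.2.2
    by_cases h0 : x.re = 0 ∨ x.im = 0
    · have := hal _ hxe (halign x h0)
      rwa [hnorm] at this
    by_cases h1 : AnalyticAt ℂ F (e + u * x)
    swap
    · have := hna _ hxe h1
      rwa [hnorm] at this
    push Not at h0
    have h2 : ‖x‖ = 2 * r := by
      by_contra h2
      exact hxn ⟨⟨lt_of_le_of_ne hxc.1 (Ne.symm h0.1), lt_of_le_of_ne hxc.2.1 (Ne.symm h0.2),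
        lt_of_le_of_ne hxc.2.2 h2⟩, h1⟩
    refine (hB x hxc.2.2).trans ?_
    rw [h2, add_mul]
    have : 1 / r * (2 * r) = 2 := by field_simp
    rw [this]
    have : 0 ≤ 2 * N * (2 * r) := by positivity
    linarith

lemma deriv_bound (F : ℂ → ℂ) (r C : ℝ) (hC : 0 ≤ C) (e₀ : ℂ) (he₀ : ¬ AnalyticAt ℂ F e₀)
    (hlip : ∀ e, dist e e₀ < 2 * r → ¬ AnalyticAt ℂ F e → ∀ z, dist z e < 2 * r →
      ‖F z - F e‖ ≤ C * ‖z - e‖)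
    (w : ℂ) (hw : dist w e₀ < r) (hwa : AnalyticAt ℂ F w) : ‖deriv F w‖ ≤ 4 * C := by
  have hcl : IsClosed {z | AnalyticAt ℂ F z}ᶜ := (isOpen_analyticAt ℂ F).isClosed_compl
  obtain ⟨e, hea, hed⟩ := hcl.exists_infDist_eq_dist ⟨e₀, he₀⟩ w
  have hle : dist w e ≤ dist w e₀ := by
    rw [← hed]; exact Metric.infDist_le_dist_of_mem he₀
  have hpos : 0 < dist w e := by
    rw [dist_pos]; rintro rfl; exact hea hwa
  set d := dist w e with hd
  have hball : ∀ z, dist z w < d → AnalyticAt ℂ F z := by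
    intro z hz
    by_contra h
    have := Metric.infDist_le_dist_of_mem (x := w) (show z ∈ {z | AnalyticAt ℂ F z}ᶜ from h)
    rw [hed, dist_comm] at this
    linarith
  have hdr : d < r := hle.trans_lt hw
  have hee : dist e e₀ < 2 * r := by
    have := dist_triangle e w e₀
    rw [dist_comm e w] at this
    linarith
  have hda : ∀ z ∈ Metric.closedBall w (d / 2), AnalyticAt ℂ F z := by
    intro z hz
    exact hball z (by rw [Metric.mem_closedBall] at hz; linarith)
  have hcauchy := Complex.norm_deriv_le_of_forall_mem_sphere_norm_le (c := w) (R := d / 2)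
    (C := C * (2 * d)) (f := fun z => F z - F e) (by linarith) ⟨?_, ?_⟩ ?_
  · rw [deriv_sub_const] at hcauchy
    refine hcauchy.trans (le_of_eq ?_)
    field_simp
    norm_num
  · intro z hz
    exact ((hda z (Metric.ball_subset_closedBall hz)).differentiableAt.sub_const
      _).differentiableWithinAt
  · intro z hz
    exact ((hda z (Metric.closure_ball_subset_closedBall hz)).continuousAt.sub
      continuousAt_const).continuousWithinAt
  · intro z hz
    rw [Metric.mem_sphere] at hz
    have h1 : dist z e ≤ 2 * d := by
      have := dist_triangle z w e
      linarith
    refine (hlip e hee hea z (by linarith)).trans ?_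
    rw [← dist_eq_norm]
    gcongr

lemma lip_ball (F : ℂ → ℂ) (r C : ℝ) (hC : 0 ≤ C) (e₀ : ℂ) (he₀ : ¬ AnalyticAt ℂ F e₀)
    (hlip : ∀ e, dist e e₀ < 2 * r → ¬ AnalyticAt ℂ F e → ∀ z, dist z e < 2 * r →
      ‖F z - F e‖ ≤ C * ‖z - e‖)
    (z w : ℂ) (hz : dist z e₀ < r) (hw : dist w e₀ < r) : ‖F w - F z‖ ≤ 4 * C * ‖w - z‖ := by
  have hseg : segment ℝ z w ⊆ Metric.ball e₀ r := (convex_ball e₀ r).segment_subset hz hw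
  have hr : 0 < r := dist_nonneg.trans_lt hz
  by_cases h : ∀ x ∈ segment ℝ z w, AnalyticAt ℂ F x
  · exact Convex.norm_image_sub_le_of_norm_deriv_le (fun x hx => (h x hx).differentiableAt)
      (fun x hx => deriv_bound F r C hC e₀ he₀ hlip x (hseg hx) (h x hx)) (convex_segment z w)
      (left_mem_segment ℝ z w) (right_mem_segment ℝ z w)
  · push Not at h
    obtain ⟨e, hes, hea⟩ := h
    have heb : dist e e₀ < r := hseg hes
    have tri : ∀ x, dist x e₀ < r → dist x e < 2 * r := by
      intro x hx
      have := dist_triangle_right x e e₀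
      linarith
    have h1 := hlip e (by linarith) hea z (tri z hz)
    have h2 := hlip e (by linarith) hea w (tri w hw)
    have h3 : ‖z - e‖ + ‖w - e‖ = ‖w - z‖ := by
      have := dist_add_dist_of_mem_segment hes
      rw [dist_eq_norm, dist_eq_norm', dist_eq_norm'] at this
      exact this
    have h4 : ‖F w - F z‖ ≤ ‖F z - F e‖ + ‖F w - F e‖ := by
      have : F w - F z = (F w - F e) - (F z - F e) := by ring
      rw [this]; exact (norm_sub_le _ _).trans (le_of_eq (add_comm _ _))
    have h5 : 0 ≤ C * ‖w - z‖ := by positivity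
    have h6 : C * ‖z - e‖ + C * ‖w - e‖ = C * ‖w - z‖ := by rw [← mul_add, h3]
    linarith

lemma diff_of_lip (F : ℂ → ℂ) (s : Set ℂ) (hs : IsOpen s) (K : NNReal)
    (hK : LipschitzOnWith K F s) (w : ℂ) (hw : w ∈ s) (hG : GatDiff F w) :
    DifferentiableAt ℂ F w := by
  obtain ⟨g, hg, heq⟩ := hK.extend_finite_dimension
  obtain ⟨d, hd⟩ := hG
  have hev : F =ᶠ[𝓝 w] g := by
    filter_upwards [hs.mem_nhds hw] with x hx using heq hx
  let L : ℂ →L[ℂ] ℂ := ContinuousLinearMap.toSpanSingleton ℂ d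
  have hright : ∀ v : ℂ, Tendsto (fun t : ℝ => t⁻¹ • (g (w + t • v) - g w)) (𝓝[>] 0)
      (𝓝 (v * d)) := by
    intro v
    refine (hd v).congr' ?_
    have hc : Tendsto (fun t : ℝ => w + (t : ℂ) * v) (𝓝[>] 0) (𝓝 w) := by
      have hc : Continuous (fun t : ℝ => w + (t : ℂ) * v) := by fun_prop
      have := hc.tendsto 0
      simp only [Complex.ofReal_zero, zero_mul, add_zero] at this
      exact this.mono_left nhdsWithin_le_nhds
    filter_upwards [hc.eventually hev] with t ht
    rw [ht, hev.self_of_nhds]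
    simp [Complex.real_smul]
  have hline : ∀ v ∈ (univ : Set ℂ), HasLineDerivAt ℝ g (L.restrictScalars ℝ v) w v := by
    intro v _
    unfold HasLineDerivAt
    rw [hasDerivAt_iff_tendsto_slope_zero]
    have hLv : (L.restrictScalars ℝ) v = v * d := by simp [L]
    rw [hLv]
    simp only [zero_add, zero_smul, add_zero]
    have hun : ({0}ᶜ : Set ℝ) = Iio 0 ∪ Ioi 0 := by
      ext x; simp
    rw [hun, nhdsWithin_union]
    refine Tendsto.sup ?_ (hright v)
    have h1 := (hright (-v)).neg
    have h2 : Tendsto (fun t : ℝ => -t) (𝓝[<] 0) (𝓝[>] 0) := by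
      have := tendsto_neg_nhdsLT (a := (0:ℝ))
      simpa using this
    have h3 := h1.comp h2
    rw [neg_mul, neg_neg] at h3
    refine h3.congr fun t => ?_
    simp [inv_neg]
  have hfd := hg.hasFDerivAt_of_hasLineDerivAt_of_closure (s := univ) (by simp) hline
  have : HasFDerivAt g L w := hasFDerivAt_of_restrictScalars ℝ hfd rfl
  exact (this.congr_of_eventuallyEq hev).differentiableAt

theorem gateaux_analytic (F : ℂ → ℂ) (U : Set ℂ) (hU : IsOpen U) (hF : ContinuousOn F U)
    (hG : ∀ w ∈ U, GatDiff F w) : AnalyticOnNhd ℂ F U := by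
  by_contra hcon
  have hne : ∃ e ∈ U, ¬ AnalyticAt ℂ F e := by
    unfold AnalyticOnNhd at hcon
    push Not at hcon
    exact hcon
  obtain ⟨n, e₀, he₀U, he₀, r₀, hr₀, hcr⟩ := cross_portion F U hU hF hG hne
  obtain ⟨r₁, hr₁, hr₁U⟩ := Metric.isOpen_iff.1 hU e₀ he₀U
  obtain ⟨r₂, hr₂, hr₂F⟩ := Metric.continuousAt_iff.1 (hF.continuousAt (hU.mem_nhds he₀U)) 1
    one_pos
  have hNp : (0:ℝ) < n + 1 := by positivity
  have hNp' : (0:ℝ) < 1 / (n + 1) := by positivity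
  obtain ⟨r, hr, hrm⟩ : ∃ r : ℝ, 0 < r ∧ 4 * r ≤ min (min r₀ r₁) (min r₂ (1 / (n + 1))) := by
    refine ⟨min (min r₀ r₁) (min r₂ (1 / (n + 1))) / 4, ?_, by linarith⟩
    have : 0 < min (min r₀ r₁) (min r₂ (1 / ((n:ℝ) + 1))) :=
      lt_min (lt_min hr₀ hr₁) (lt_min hr₂ hNp')
    linarith
  simp only [le_min_iff] at hrm
  obtain ⟨⟨hm0, hm1⟩, hm2, hm3⟩ := hrm
  have hsub : Metric.ball e₀ (4 * r) ⊆ U := (Metric.ball_subset_ball hm1).trans hr₁U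
  have hlip := lip_at F U hF (n + 1) r hNp hr e₀ hsub
    (fun z hz => by
      have := hr₂F (lt_of_lt_of_le hz hm2)
      rw [dist_eq_norm] at this; exact this.le) hm3
    (fun e he hea => hcr e (hsub he) hea (lt_of_lt_of_le he hm0))
  have hC : (0:ℝ) ≤ 2 * (n + 1) + 1 / r := by positivity
  have hK : LipschitzOnWith (4 * (2 * (n + 1) + 1 / r)).toNNReal F (Metric.ball e₀ r) := by
    refine LipschitzOnWith.of_dist_le_mul fun x hx y hy => ?_
    rw [Real.coe_toNNReal _ (by positivity), dist_eq_norm, dist_eq_norm]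
    exact lip_ball F r _ hC e₀ he₀ (fun e h1 h2 z h3 => hlip e h1 h2 z h3) y x hy hx
  have hdiff : DifferentiableOn ℂ F (Metric.ball e₀ r) := fun w hw =>
    (diff_of_lip F _ Metric.isOpen_ball _ hK w hw
      (hG w (hsub (Metric.ball_subset_ball (by linarith) hw)))).differentiableWithinAt
  exact he₀ (hdiff.analyticAt (Metric.ball_mem_nhds e₀ hr))

lemma xi_section (a b : ℂ)
    (hab : a ∉ Set.range ((↑) : ℝ → ℂ) ∨ b ∉ Set.range ((↑) : ℝ → ℂ)) :
    ∃ s : ℂ → ℝ × ℝ × ℝ, Continuous s ∧ s 0 = 0 ∧ (∀ w, xi a b (s w) = w) ∧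
      ∀ (t : ℝ) w, s ((t : ℂ) * w) = t • s w := by
  have him : ∀ c : ℂ, c ∉ Set.range ((↑) : ℝ → ℂ) → c.im ≠ 0 := by
    intro c hc h
    exact hc ⟨c.re, Complex.ext (by simp) (by simp [h])⟩
  rcases hab with h | h
  · have h := him _ h
    refine ⟨fun w => (w.re - w.im / a.im * a.re, w.im / a.im, 0), by fun_prop, by simp, ?_, ?_⟩
    · intro w
      apply Complex.ext <;> simp [xi, h]
    · intro t w
      simp only [Prod.smul_mk, smul_eq_mul, Complex.re_ofReal_mul, Complex.im_ofReal_mul,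
        Prod.mk.injEq]
      refine ⟨by ring, by ring, by ring⟩
  · have h := him _ h
    refine ⟨fun w => (w.re - w.im / b.im * b.re, 0, w.im / b.im), by fun_prop, by simp, ?_, ?_⟩
    · intro w
      apply Complex.ext <;> simp [xi, h]
    · intro t w
      simp only [Prod.smul_mk, smul_eq_mul, Complex.re_ofReal_mul, Complex.im_ofReal_mul,
        Prod.mk.injEq]
      refine ⟨by ring, by ring, by ring⟩

lemma xi_add (a b : ℂ) (p q : ℝ × ℝ × ℝ) : xi a b (p + q) = xi a b p + xi a b q := by
  simp only [xi, Prod.fst_add, Prod.snd_add, Complex.ofReal_add]; ring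

lemma xi_sub (a b : ℂ) (p q : ℝ × ℝ × ℝ) : xi a b (p - q) = xi a b p - xi a b q := by
  simp only [xi, Prod.fst_sub, Prod.snd_sub, Complex.ofReal_sub]; ring

lemma mem_lineL (a b : ℂ) (p : ℝ × ℝ × ℝ) (h : xi a b p = 0) : p ∈ lineL a b := by
  have h1 := congrArg Complex.re h
  have h2 := congrArg Complex.im h
  simp [xi] at h1 h2
  exact ⟨h1, h2⟩

lemma const_on_line (a b : ℂ) (Ω : Set (ℝ × ℝ × ℝ))
    (hconv : ConvexInDirection Ω (lineL a b)) (g : ℝ × ℝ × ℝ → ℂ) (hg : ContinuousOn g Ω)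
    (hd : ∀ p ∈ Ω, ∃ d : ℂ, ∀ v, Tendsto (fun ε : ℝ => ((ε : ℂ))⁻¹ * (g (p + ε • v) - g p))
      (nhdsWithin 0 (Set.Ioi 0)) (nhds (xi a b v * d)))
    (p q : ℝ × ℝ × ℝ) (hp : p ∈ Ω) (hq : q ∈ Ω) (h : xi a b p = xi a b q) : g q = g p := by
  have hv : xi a b (q - p) = 0 := by rw [xi_sub, h, sub_self]
  have hseg := hconv p hp q hq (mem_lineL a b _ hv)
  have hmem : ∀ t ∈ Icc (0:ℝ) 1, p + t • (q - p) ∈ Ω := by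
    intro t ht
    apply hseg
    rw [segment_eq_image']
    exact ⟨t, ht, rfl⟩
  have hc : ContinuousOn (fun t : ℝ => g (p + t • (q - p))) (Icc 0 1) := by
    refine hg.comp (Continuous.continuousOn ?_) hmem
    fun_prop
  have := constant_of_has_deriv_right_zero hc ?_ 1 (by simp)
  · simpa using this
  · intro t ht
    obtain ⟨d, hd⟩ := hd _ (hmem t ⟨ht.1, ht.2.le⟩)
    have h1 := hd (q - p)
    rw [hv, zero_mul] at h1
    rw [hasDerivWithinAt_iff_tendsto_slope, show Ici t \ {t} = Ioi t by simp]
    have h2 : Tendsto (fun x : ℝ => x - t) (𝓝[>] t) (𝓝[>] 0) := by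
      refine tendsto_nhdsWithin_iff.2 ⟨?_, ?_⟩
      · have hcc : Continuous (fun x : ℝ => x - t) := by fun_prop
        have := hcc.tendsto t
        rw [sub_self] at this
        exact this.mono_left nhdsWithin_le_nhds
      · filter_upwards [self_mem_nhdsWithin] with x hx
        exact mem_Ioi.2 (sub_pos.2 (mem_Ioi.1 hx))
    refine (h1.comp h2).congr fun x => ?_
    simp only [Function.comp, slope_def_module]
    rw [add_assoc, ← add_smul, add_sub_cancel, Complex.real_smul, Complex.ofReal_inv]

lemma rep (a b : ℂ)
    (hab : a ∉ Set.range ((↑) : ℝ → ℂ) ∨ b ∉ Set.range ((↑) : ℝ → ℂ))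
    (Ω : Set (ℝ × ℝ × ℝ)) (hΩ : IsOpen Ω)
    (hconv : ConvexInDirection Ω (lineL a b)) (g : ℝ × ℝ × ℝ → ℂ) (hg : ContinuousOn g Ω)
    (hd : ∀ p ∈ Ω, ∃ d : ℂ, ∀ v, Tendsto (fun ε : ℝ => ((ε : ℂ))⁻¹ * (g (p + ε • v) - g p))
      (nhdsWithin 0 (Set.Ioi 0)) (nhds (xi a b v * d))) :
    ∃ F : ℂ → ℂ, AnalyticOnNhd ℂ F (xi a b '' Ω) ∧ ∀ p ∈ Ω, F (xi a b p) = g p := by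
  classical
  obtain ⟨s, hsc, hs0, hsx, hsm⟩ := xi_section a b hab
  let F : ℂ → ℂ := fun w => if h : ∃ p ∈ Ω, xi a b p = w then g h.choose else 0
  have hF : ∀ p ∈ Ω, F (xi a b p) = g p := by
    intro p hp
    have h : ∃ q ∈ Ω, xi a b q = xi a b p := ⟨p, hp, rfl⟩
    have : F (xi a b p) = g h.choose := by simp only [F]; rw [dif_pos h]
    rw [this]
    exact const_on_line a b Ω hconv g hg hd p _ hp h.choose_spec.1 h.choose_spec.2.symm
  have hnear : ∀ p ∈ Ω, ∀ᶠ w in 𝓝 (xi a b p), p + s (w - xi a b p) ∈ Ω := by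
    intro p hp
    have hcc : Continuous (fun w => p + s (w - xi a b p)) := by fun_prop
    exact hcc.continuousAt.eventually_mem (by simp [hs0]; exact hΩ.mem_nhds hp)
  have hxis : ∀ p w, xi a b (p + s (w - xi a b p)) = w := by
    intro p w; rw [xi_add, hsx]; ring
  have hloc : ∀ p ∈ Ω, ∀ᶠ w in 𝓝 (xi a b p), F w = g (p + s (w - xi a b p)) := by
    intro p hp
    filter_upwards [hnear p hp] with w hw
    rw [← hF _ hw, hxis]
  refine ⟨F, ?_, hF⟩
  apply gateaux_analytic
  · rw [isOpen_iff_mem_nhds]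
    rintro _ ⟨p, hp, rfl⟩
    filter_upwards [hnear p hp] with w hw
    exact ⟨_, hw, hxis p w⟩
  · rintro _ ⟨p, hp, rfl⟩
    apply ContinuousAt.continuousWithinAt
    have h1 : ContinuousAt (fun w => g (p + s (w - xi a b p))) (xi a b p) := by
      have hcc : Continuous (fun w => p + s (w - xi a b p)) := by fun_prop
      refine ContinuousAt.comp (g := g) ?_ hcc.continuousAt
      simp only [sub_self, hs0, add_zero]
      exact hg.continuousAt (hΩ.mem_nhds hp)
    exact h1.congr ((hloc p hp).mono fun w hw => hw.symm)
  · rintro _ ⟨p, hp, rfl⟩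
    obtain ⟨d, hd⟩ := hd p hp
    refine ⟨d, fun v => ?_⟩
    have h1 := hd (s v)
    rw [hsx] at h1
    refine h1.congr' ?_
    have hc : Tendsto (fun t : ℝ => xi a b p + (t : ℂ) * v) (𝓝[>] 0) (𝓝 (xi a b p)) := by
      have hc : Continuous (fun t : ℝ => xi a b p + (t : ℂ) * v) := by fun_prop
      have := hc.tendsto 0
      simp only [Complex.ofReal_zero, zero_mul, add_zero] at this
      exact this.mono_left nhdsWithin_le_nhds
    filter_upwards [hc.eventually (hloc p hp)] with t ht
    rw [ht, hF p hp, add_sub_cancel_left, hsm]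

lemma cont_coords : Continuous (fun q : HC => (q.re, q.imI, q.imJ, q.imK)) :=
  continuous_induced_dom

lemma cont_re : Continuous (fun q : HC => q.re) := continuous_fst.comp cont_coords
lemma cont_imI : Continuous (fun q : HC => q.imI) :=
  (continuous_fst.comp continuous_snd).comp cont_coords
lemma cont_imJ : Continuous (fun q : HC => q.imJ) :=
  (continuous_fst.comp (continuous_snd.comp continuous_snd)).comp cont_coords
lemma cont_imK : Continuous (fun q : HC => q.imK) :=
  (continuous_snd.comp (continuous_snd.comp continuous_snd)).comp cont_coords

lemma cont_c1 : Continuous c1 := cont_re.sub (continuous_const.mul cont_imI)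
lemma cont_c3 : Continuous c3 := (continuous_const.mul cont_imJ).neg.sub cont_imK
lemma cont_c4 : Continuous c4 := (continuous_const.mul cont_imJ).neg.add cont_imK

lemma cont_zeta (i2 i3 : HC) : Continuous (zeta i2 i3) := by
  rw [continuous_induced_rng]
  simp only [Function.comp_def, zeta, QuaternionAlgebra.re_add, QuaternionAlgebra.imI_add,
    QuaternionAlgebra.imJ_add, QuaternionAlgebra.imK_add, QuaternionAlgebra.re_smul,
    QuaternionAlgebra.imI_smul, QuaternionAlgebra.imJ_smul, QuaternionAlgebra.imK_smul]
  fun_prop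

lemma zeta_add_smul (i2 i3 : HC) (p v : ℝ × ℝ × ℝ) (t : ℝ) :
    zeta i2 i3 (p + t • v) = zeta i2 i3 p + (t : ℂ) • zeta i2 i3 v := by
  simp only [zeta, Prod.fst_add, Prod.snd_add, Prod.smul_fst, Prod.smul_snd, smul_eq_mul,
    Complex.ofReal_add, Complex.ofReal_mul, add_smul, smul_add, mul_smul]
  abel

lemma coords_smul_sub (t : ℂ) (x y : HC) : c1 (t • (x - y)) = t * (c1 x - c1 y) ∧
    c3 (t • (x - y)) = t * (c3 x - c3 y) ∧ c4 (t • (x - y)) = t * (c4 x - c4 y) := by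
  refine ⟨?_, ?_, ?_⟩ <;> simp [c1, c3, c4] <;> ring

lemma zeta_eq (a₁ a₂ b₁ b₂ : ℂ) (p : ℝ × ℝ × ℝ) :
    zeta (a₁ • e1 + a₂ • e2) (b₁ • e1 + b₂ • e2) p = xi a₁ b₁ p • e1 + xi a₂ b₂ p • e2 := by
  ext <;> simp [zeta, xi, e1, e2] <;> ring

lemma coords_comb (x y : ℂ) : c1 (x • e1 + y • e2) = x ∧ c3 (x • e1 + y • e2) = 0 := by
  constructor
  · simp [c1, e1, e2]; ring_nf; simp; ring
  · simp [c3, e1, e2]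

lemma coords_mul (x y : ℂ) (q : HC) : c1 ((x • e1 + y • e2) * q) = x * c1 q ∧
    c3 ((x • e1 + y • e2) * q) = x * c3 q ∧ c1 (q * (x • e1 + y • e2)) = x * c1 q ∧
    c4 (q * (x • e1 + y • e2)) = x * c4 q := by
  refine ⟨?_, ?_, ?_, ?_⟩ <;> simp [c1, c3, c4, e1, e2] <;> ring_nf <;> simp <;> ring

lemma I2_eq (q : HC) (h : q ∈ I2) : q = c1 q • e1 + c3 q • e3 := by
  obtain ⟨x, y, rfl⟩ := h
  have h1 : c1 (x • e1 + y • e3) = x := by simp [c1, e1, e3]; ring_nf; simp; ring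
  have h2 : c3 (x • e1 + y • e3) = y := by simp [c3, e1, e3]; ring_nf; simp; ring
  rw [h1, h2]

lemma Ih2_eq (q : HC) (h : q ∈ Ih2) : q = c1 q • e1 + c4 q • e4 := by
  obtain ⟨x, y, rfl⟩ := h
  have h1 : c1 (x • e1 + y • e4) = x := by simp [c1, e1, e4]; ring_nf; simp; ring
  have h2 : c4 (x • e1 + y • e4) = y := by simp [c4, e1, e4]; ring_nf; simp; ring
  rw [h1, h2]

/-- Theorem 4: on a domain convex in the direction of `L₁`, every right-G-monogenic
map valued in `𝓘₂` has the form `F₂₁(ξ₁)e₁ + F₂₃(ξ₁)e₃`, and every left-G-monogenic map valued in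
`𝓘̂₂` has the form `F₂₂(ξ₁)e₁ + F₂₄(ξ₁)e₄`, with the `F`'s analytic on `D₁ = f₁(Ω_ζ)`. -/
theorem statement11 (a₁ a₂ b₁ b₂ : ℂ) (i2 i3 : HC)
    (hi2 : i2 = a₁ • e1 + a₂ • e2) (hi3 : i3 = b₁ • e1 + b₂ • e2)
    (hLI : LinIndep i2 i3)
    (Ω : Set (ℝ × ℝ × ℝ)) (hΩo : IsOpen Ω) (hΩc : IsConnected Ω)
    (hconv1 : ConvexInDirection Ω (lineL a₁ b₁))
    (hab1 : a₁ ∉ Set.range ((↑) : ℝ → ℂ) ∨ b₁ ∉ Set.range ((↑) : ℝ → ℂ))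
    (hab2 : a₂ ∉ Set.range ((↑) : ℝ → ℂ) ∨ b₂ ∉ Set.range ((↑) : ℝ → ℂ)) :
    (∀ Φ : HC → HC, RightGMonogenic i2 i3 Φ (zeta i2 i3 '' Ω) →
      (∀ ζ ∈ zeta i2 i3 '' Ω, Φ ζ ∈ I2) →
      ∃ F21 F23 : ℂ → ℂ,
        AnalyticOnNhd ℂ F21 (f1 '' (zeta i2 i3 '' Ω)) ∧
        AnalyticOnNhd ℂ F23 (f1 '' (zeta i2 i3 '' Ω)) ∧
        ∀ p ∈ Ω, Φ (zeta i2 i3 p) = F21 (xi a₁ b₁ p) • e1 + F23 (xi a₁ b₁ p) • e3) ∧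
    (∀ Φh : HC → HC, LeftGMonogenic i2 i3 Φh (zeta i2 i3 '' Ω) →
      (∀ ζ ∈ zeta i2 i3 '' Ω, Φh ζ ∈ Ih2) →
      ∃ F22 F24 : ℂ → ℂ,
        AnalyticOnNhd ℂ F22 (f1 '' (zeta i2 i3 '' Ω)) ∧
        AnalyticOnNhd ℂ F24 (f1 '' (zeta i2 i3 '' Ω)) ∧
        ∀ p ∈ Ω, Φh (zeta i2 i3 p) = F22 (xi a₁ b₁ p) • e1 + F24 (xi a₁ b₁ p) • e4) := by
  subst hi2 hi3
  have himg : f1 '' (zeta (a₁ • e1 + a₂ • e2) (b₁ • e1 + b₂ • e2) '' Ω) = xi a₁ b₁ '' Ω := by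
    rw [image_image]
    refine image_congr fun p _ => ?_
    rw [zeta_eq, f1, (coords_comb _ _).1, (coords_comb _ _).2, add_zero]
  rw [himg]
  -- general coordinate statement
  have gen : ∀ (c : HC → ℂ), Continuous c →
      (∀ (t : ℂ) (x y : HC), c (t • (x - y)) = t * (c x - c y)) →
      ∀ (m : HC → HC → HC) (_ : ∀ (x y : ℂ) (q : HC), c (m (x • e1 + y • e2) q) = x * c q)
        (Φ : HC → HC), ContinuousOn Φ (zeta (a₁ • e1 + a₂ • e2) (b₁ • e1 + b₂ • e2) '' Ω) →
      (∀ ζ ∈ zeta (a₁ • e1 + a₂ • e2) (b₁ • e1 + b₂ • e2) '' Ω, ∃ Φ' : HC,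
        ∀ h ∈ E3 (a₁ • e1 + a₂ • e2) (b₁ • e1 + b₂ • e2),
        Tendsto (fun ε : ℝ => ((ε : ℂ))⁻¹ • (Φ (ζ + (ε : ℂ) • h) - Φ ζ))
          (nhdsWithin 0 (Set.Ioi 0)) (nhds (m h Φ'))) →
      ∃ F : ℂ → ℂ, AnalyticOnNhd ℂ F (xi a₁ b₁ '' Ω) ∧
        ∀ p ∈ Ω, F (xi a₁ b₁ p) = c (Φ (zeta (a₁ • e1 + a₂ • e2) (b₁ • e1 + b₂ • e2) p)) := by
    intro c hc hlin m hm Φ hΦ hder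
    refine rep a₁ b₁ hab1 Ω hΩo hconv1
      (fun p => c (Φ (zeta (a₁ • e1 + a₂ • e2) (b₁ • e1 + b₂ • e2) p))) ?_ ?_
    · exact hc.comp_continuousOn
        (hΦ.comp (cont_zeta _ _).continuousOn fun p hp => mem_image_of_mem _ hp)
    · intro p hp
      obtain ⟨Φ', h'⟩ := hder _ (mem_image_of_mem _ hp)
      refine ⟨c Φ', fun v => ?_⟩
      have h1 := (hc.tendsto _).comp (h' (zeta _ _ v) ⟨v, rfl⟩)
      rw [zeta_eq a₁ a₂ b₁ b₂ v, hm] at h1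
      refine h1.congr fun t => ?_
      simp only [Function.comp]
      rw [hlin, ← zeta_eq, ← zeta_add_smul]
  refine ⟨?_, ?_⟩
  · intro Φ hΦ hI
    obtain ⟨F1, hF1, hF1'⟩ := gen c1 cont_c1 (fun t x y => (coords_smul_sub t x y).1)
      (fun h q => h * q) (fun x y q => (coords_mul x y q).1) Φ hΦ.1 hΦ.2
    obtain ⟨F3, hF3, hF3'⟩ := gen c3 cont_c3 (fun t x y => (coords_smul_sub t x y).2.1)
      (fun h q => h * q) (fun x y q => (coords_mul x y q).2.1) Φ hΦ.1 hΦ.2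
    refine ⟨F1, F3, hF1, hF3, fun p hp => ?_⟩
    rw [hF1' p hp, hF3' p hp]
    exact I2_eq _ (hI _ (mem_image_of_mem _ hp))
  · intro Φ hΦ hI
    obtain ⟨F1, hF1, hF1'⟩ := gen c1 cont_c1 (fun t x y => (coords_smul_sub t x y).1)
      (fun h q => q * h) (fun x y q => (coords_mul x y q).2.2.1) Φ hΦ.1 hΦ.2
    obtain ⟨F3, hF3, hF3'⟩ := gen c4 cont_c4 (fun t x y => (coords_smul_sub t x y).2.2)
      (fun h q => q * h) (fun x y q => (coords_mul x y q).2.2.2) Φ hΦ.1 hΦ.2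
    refine ⟨F1, F3, hF1, hF3, fun p hp => ?_⟩
    rw [hF1' p hp, hF3' p hp]
    exact Ih2_eq _ (hI _ (mem_image_of_mem _ hp))

end
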